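/- arXiv:2507.15445 — 3 statements merged into one kernel-verified Lean document; each statement's English description precedes it below -/
import Mathlib

section
/- Let V be a type, G : SimpleGraph V a simple graph, and a, b : V. Then the graph G ⊔ fromEdgeSet {s(a,b)} (the graph G with an edge between a and b added) is connected if and only if V is nonempty and every vertex x : V satisfies G.Reachable a x or G.Reachable b x. -/
/-- After adding an edge between `a` and `b`, the vertices reachable from `a` are exactly
those previously reachable from `a` or from `b`. -/
theorem SimpleGraph.reachable_sup_fromEdgeSet_pair_left_iff {V : Type*} (G : SimpleGraph V)
    (a b x : V) :
    (G ⊔ SimpleGraph.fromEdgeSet {s(a, b)}).Reachable a x ↔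
      G.Reachable a x ∨ G.Reachable b x := by
  constructor
  · intro h
    rw [SimpleGraph.reachable_iff_reflTransGen] at h
    induction h with
    | refl => exact Or.inl (SimpleGraph.Reachable.refl a)
    | tail _ hyz ih =>
      rw [SimpleGraph.sup_adj, SimpleGraph.fromEdgeSet_adj, Set.mem_singleton_iff,
        Sym2.eq_iff] at hyz
      rcases hyz with hyz | ⟨⟨rfl, rfl⟩ | ⟨rfl, rfl⟩, _⟩
      · exact ih.imp (fun h => h.trans hyz.reachable) (fun h => h.trans hyz.reachable)
      · exact Or.inr (SimpleGraph.Reachable.refl _)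
      · exact Or.inl (SimpleGraph.Reachable.refl _)
  · rintro (h | h)
    · exact h.mono le_sup_left
    · refine SimpleGraph.Reachable.trans ?_ (h.mono le_sup_left)
      rcases eq_or_ne a b with rfl | hab
      · exact SimpleGraph.Reachable.refl a
      · exact SimpleGraph.Adj.reachable (Or.inr ⟨rfl, hab⟩)

/-- Adding an edge between `a` and `b` to a simple graph `G` yields a connected graph
if and only if the vertex type is nonempty and every vertex is reachable in `G`
from `a` or from `b`.  This is the graph-theoretic fact underlying the splitting of a
vertex of a connected graph into two vertices: the result has at most two connected
components, containing the two daughter vertices respectively. -/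
theorem connected_sup_single_edge_iff {V : Type*} (G : SimpleGraph V) (a b : V) :
    (G ⊔ SimpleGraph.fromEdgeSet {s(a, b)}).Connected ↔
      (Nonempty V ∧ ∀ x : V, G.Reachable a x ∨ G.Reachable b x) := by
  simp_rw [← SimpleGraph.reachable_sup_fromEdgeSet_pair_left_iff]
  exact ⟨fun h => ⟨h.nonempty, h.preconnected a⟩,
    fun ⟨_, h⟩ => ⟨fun x y => (h x).symm.trans (h y)⟩⟩
end

section
/- Let R be a commutative ring, μ ∈ R, let B : R → R → R be additive in each argument and a derivation in each argument (B(x, y*z) = B(x,y)*z + y*B(x,z) and B(x*y, z) = x*B(y,z) + B(x,z)*y for all x, y, z), and let d : R → R be an additive map satisfying the twisted Leibniz rule d(x*y) = d x * y + x * d y + μ * B(x,y) for all x, y ∈ R. Then for every m ≥ 1 and every y : Fin m → R, d(∏_{i} y i) = Σ_{i} d(y i) * ∏_{l ≠ i} y l + μ * Σ_{i < j} B(y i, y j) * ∏_{l ≠ i, l ≠ j} y l. -/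
open Finset

/-- The Leibniz rule for a finite product, for a map that is not assumed to be additive. -/
theorem leibniz_prod_univ {R : Type*} [CommRing R] (f : R → R)
    (hf : ∀ x y : R, f (x * y) = f x * y + x * f y) (n : ℕ) (y : Fin n → R) :
    f (∏ i, y i) = ∑ i, f (y i) * ∏ l ∈ Finset.univ.filter (fun l => l ≠ i), y l := by
  induction n with
  | zero => simpa using hf 1 1
  | succ n ih =>
    rw [Fin.prod_univ_succ, hf, ih, Fin.sum_univ_succ]
    simp only [Finset.prod_filter, Fin.prod_univ_succ, Finset.mul_sum]
    simp [(Fin.succ_ne_zero _).symm, mul_left_comm]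

/-- Expansion of a Beilinson–Drinfeld differential on an `m`-fold product: if
`d` is additive and satisfies the twisted Leibniz rule
`d (x * y) = d x * y + x * d y + μ * B x y` with respect to a bracket `B` that is
additive and a derivation in each argument, then `d` applied to the product
`∏ i, y i` equals the sum of the terms `d (y i)` times the remaining product, plus
`μ` times the sum over pairs `i < j` of `B (y i) (y j)` times the remaining product.
(Sign-free core of equation (22) of the paper.) -/
theorem bd_differential_on_product {R : Type*} [CommRing R] (μ : R) (B : R → R → R)
    (hBaddLeft : ∀ x y z : R, B (x + y) z = B x z + B y z)
    (hBaddRight : ∀ x y z : R, B x (y + z) = B x y + B x z)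
    (hBderRight : ∀ x y z : R, B x (y * z) = B x y * z + y * B x z)
    (hBderLeft : ∀ x y z : R, B (x * y) z = x * B y z + B x z * y)
    (d : R → R)
    (hdadd : ∀ x y : R, d (x + y) = d x + d y)
    (hdLeib : ∀ x y : R, d (x * y) = d x * y + x * d y + μ * B x y)
    (m : ℕ) (hm : 1 ≤ m) (y : Fin m → R) :
    d (∏ i, y i) =
      (∑ i, d (y i) * ∏ l ∈ Finset.univ.filter (fun l => l ≠ i), y l) +
      μ * ∑ i, ∑ j ∈ Finset.univ.filter (fun j => i < j),
        B (y i) (y j) * ∏ l ∈ Finset.univ.filter (fun l => l ≠ i ∧ l ≠ j), y l := by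
  clear hm
  induction m with
  | zero =>
    have hB : B 1 1 = 0 := by simpa using hBderRight 1 1 1
    simpa [hB] using hdLeib 1 1
  | succ m ih =>
    rw [Fin.prod_univ_succ, hdLeib, ih, leibniz_prod_univ (B (y 0)) (hBderRight (y 0))]
    simp only [Fin.sum_univ_succ, Finset.sum_filter, Finset.prod_filter, Fin.prod_univ_succ,
      Finset.mul_sum, mul_add]
    simp [(Fin.succ_ne_zero _).symm, mul_left_comm]
    ring
end

section
/- Let k be a commutative ring and let A, B be commutative k-algebras. Let P_A : A → A → A and P_B : B → B → B be k-bilinear maps which are antisymmetric (P x y = −P y x), satisfy the Jacobi identity (P x (P y z) = P (P x y) z + P y (P x z)), and are derivations in the second argument (P x (y*z) = (P x y)*z + y*(P x z)). Then there exists a k-bilinear map P : (A ⊗[k] B) → (A ⊗[k] B) → (A ⊗[k] B) satisfying P (a1 ⊗ b1) (a2 ⊗ b2) = (P_A a1 a2) ⊗ (b1 * b2) + (a1 * a2) ⊗ (P_B b1 b2) on pure tensors, and any such P is antisymmetric, satisfies the Jacobi identity, and is a derivation in the second argument. -/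
open scoped TensorProduct

/-- Given commutative `k`-algebras `A` and `B` equipped with `k`-bilinear brackets that
are antisymmetric, satisfy the Jacobi identity, and are derivations in the second
argument, there is a `k`-bilinear bracket on `A ⊗[k] B` given on pure tensors by
`P (a1 ⊗ b1) (a2 ⊗ b2) = (P_A a1 a2) ⊗ (b1 b2) + (a1 a2) ⊗ (P_B b1 b2)`, and any such
bracket is antisymmetric, satisfies the Jacobi identity, and is a derivation in the
second argument.  (Sign-free core of Lemma 2.3 of the paper.) -/
theorem tensorProduct_poisson_bracket (k A B : Type*) [CommRing k]
    [CommRing A] [CommRing B] [Algebra k A] [Algebra k B]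
    (PA : A →ₗ[k] A →ₗ[k] A) (PB : B →ₗ[k] B →ₗ[k] B)
    (hAanti : ∀ x y : A, PA x y = - PA y x)
    (hAjac : ∀ x y z : A, PA x (PA y z) = PA (PA x y) z + PA y (PA x z))
    (hAder : ∀ x y z : A, PA x (y * z) = PA x y * z + y * PA x z)
    (hBanti : ∀ x y : B, PB x y = - PB y x)
    (hBjac : ∀ x y z : B, PB x (PB y z) = PB (PB x y) z + PB y (PB x z))
    (hBder : ∀ x y z : B, PB x (y * z) = PB x y * z + y * PB x z) :
    (∃ P : (A ⊗[k] B) →ₗ[k] (A ⊗[k] B) →ₗ[k] (A ⊗[k] B),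
      ∀ (a1 a2 : A) (b1 b2 : B),
        P (a1 ⊗ₜ[k] b1) (a2 ⊗ₜ[k] b2) =
          (PA a1 a2) ⊗ₜ[k] (b1 * b2) + (a1 * a2) ⊗ₜ[k] (PB b1 b2)) ∧
    (∀ P : (A ⊗[k] B) →ₗ[k] (A ⊗[k] B) →ₗ[k] (A ⊗[k] B),
      (∀ (a1 a2 : A) (b1 b2 : B),
        P (a1 ⊗ₜ[k] b1) (a2 ⊗ₜ[k] b2) =
          (PA a1 a2) ⊗ₜ[k] (b1 * b2) + (a1 * a2) ⊗ₜ[k] (PB b1 b2)) →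
      (∀ x y : A ⊗[k] B, P x y = - P y x) ∧
      (∀ x y z : A ⊗[k] B, P x (P y z) = P (P x y) z + P y (P x z)) ∧
      (∀ x y z : A ⊗[k] B, P x (y * z) = P x y * z + y * P x z)) := by
  refine ⟨⟨TensorProduct.map₂ PA (LinearMap.mul k B) +
    TensorProduct.map₂ (LinearMap.mul k A) PB, fun a1 a2 b1 b2 => by simp⟩, fun P hP => ?_⟩
  have hAder' (x y z : A) : PA (x * y) z = PA x z * y + x * PA y z := by
    rw [hAanti, hAder, hAanti z x, hAanti z y]; ring
  have hBder' (x y z : B) : PB (x * y) z = PB x z * y + x * PB y z := by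
    rw [hBanti, hBder, hBanti z x, hBanti z y]; ring
  refine ⟨fun x y => ?_, fun x y z => ?_, fun x y z => ?_⟩
  · induction x with
    | zero => simp
    | add x₁ x₂ h₁ h₂ => simp only [map_add, LinearMap.add_apply, h₁, h₂, neg_add]
    | tmul a₁ b₁ =>
      induction y with
      | zero => simp
      | add y₁ y₂ h₁ h₂ => simp only [map_add, LinearMap.add_apply, h₁, h₂, neg_add]
      | tmul a₂ b₂ =>
        rw [hP, hP, hAanti a₁, hBanti b₁, mul_comm a₁, mul_comm b₁, TensorProduct.neg_tmul,
          TensorProduct.tmul_neg, neg_add]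
  · induction x with
    | zero => simp
    | add x₁ x₂ h₁ h₂ => simp only [map_add, LinearMap.add_apply, h₁, h₂]; abel
    | tmul a₁ b₁ =>
      induction y with
      | zero => simp
      | add y₁ y₂ h₁ h₂ => simp only [map_add, LinearMap.add_apply, h₁, h₂]; abel
      | tmul a₂ b₂ =>
        induction z with
        | zero => simp
        | add z₁ z₂ h₁ h₂ => simp only [map_add, h₁, h₂]; abel
        | tmul a₃ b₃ =>
          simp only [hP, map_add, LinearMap.add_apply, hAder, hBder, hAder', hBder',
            hAjac a₁, hBjac b₁, hAanti a₂ a₁, hBanti b₂ b₁, TensorProduct.add_tmul,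
            TensorProduct.tmul_add, mul_neg, TensorProduct.neg_tmul,
            TensorProduct.tmul_neg, mul_comm, mul_left_comm]
          abel
  · induction x with
    | zero => simp
    | add x₁ x₂ h₁ h₂ =>
      simp only [map_add, LinearMap.add_apply, h₁, h₂]; ring
    | tmul a₁ b₁ =>
      induction y with
      | zero => simp
      | add y₁ y₂ h₁ h₂ => simp only [map_add, add_mul, h₁, h₂]; ring
      | tmul a₂ b₂ =>
        induction z with
        | zero => simp
        | add z₁ z₂ h₁ h₂ => simp only [map_add, mul_add, h₁, h₂]; ring
        | tmul a₃ b₃ =>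
          simp only [hP, Algebra.TensorProduct.tmul_mul_tmul, hAder, hBder, mul_add,
            TensorProduct.add_tmul, TensorProduct.tmul_add, mul_comm, mul_left_comm]
          abel
end
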